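/- (Genericity of the 2^K modes) Let K be a positive natural number and let β_1,…,β_K be strictly positive real numbers. Then the set of phase vectors θ = (θ_1,…,θ_K) ∈ ℝ^K for which there exist two distinct subsets S ≠ T of {1,…,K} with Σ_{k∈S} β_k e^{iθ_k} = Σ_{k∈T} β_k e^{iθ_k} has Lebesgue measure zero in ℝ^K. Consequently, for Lebesgue-almost every θ, the 2^K subset sums Σ_{k∈S} β_k e^{iθ_k}, S ⊆ {1,…,K}, are pairwise distinct. -/

import Mathlib

open MeasureTheory Finset

lemma countable_setOf_exp_I_mul_eq (z : ℂ) :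
    {x : ℝ | Complex.exp (Complex.I * (x : ℂ)) = z}.Countable := by
  refine ((Set.countable_singleton z).preimage_cexp.preimage
    (f := fun x : ℝ => Complex.I * (x : ℂ)) fun x y h => ?_)
  exact Complex.ofReal_injective (mul_left_cancel₀ Complex.I_ne_zero h)

/-- A trigonometric sum with a nonzero coefficient vanishes only on a null set of phases. -/
lemma ae_sum_mul_exp_I_mul_ne_zero {ι : Type*} [Fintype ι] (c : ι → ℂ) {j : ι} (hj : c j ≠ 0) :
    ∀ᵐ θ : ι → ℝ, ∑ k, c k * Complex.exp (Complex.I * (θ k : ℂ)) ≠ 0 := by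
  classical
  have hs : MeasurableSet
      {θ : ι → ℝ | ∑ k, c k * Complex.exp (Complex.I * (θ k : ℂ)) ≠ 0} :=
    (isOpen_ne_fun (by fun_prop) continuous_const).measurableSet
  refine ae_mem_of_ae_add_linearMap_mem (LinearMap.single ℝ (fun _ : ι => ℝ) j)
    (volume : Measure ℝ) volume hs fun θ => ?_
  set w := ∑ k ∈ univ.erase j, c k * Complex.exp (Complex.I * (θ k : ℂ))
  have hc := countable_setOf_exp_I_mul_eq
    (-w / (c j * Complex.exp (Complex.I * (θ j : ℂ))))
  filter_upwards [hc.ae_notMem volume] with x hx h0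
  apply hx
  have hrest : ∑ k ∈ univ.erase j, c k *
      Complex.exp (Complex.I * ((θ + LinearMap.single ℝ (fun _ : ι => ℝ) j x) k : ℝ)) = w :=
    sum_congr rfl fun k hk => by simp [Pi.single_eq_of_ne (ne_of_mem_erase hk)]
  rw [← add_sum_erase _ _ (mem_univ j), hrest] at h0
  simp only [Pi.add_apply, LinearMap.coe_single, Pi.single_eq_same, Complex.ofReal_add, mul_add,
    Complex.exp_add] at h0
  rw [eq_div_iff (mul_ne_zero hj (Complex.exp_ne_zero _))]
  linear_combination h0

/-- For nonzero amplitudes, the subset sums of the modes are almost surely pairwise distinct. -/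
lemma ae_subset_sums_ne {ι : Type*} [Fintype ι] (b : ι → ℂ) (hb : ∀ k, b k ≠ 0) :
    ∀ᵐ θ : ι → ℝ, ∀ S T : Finset ι, S ≠ T →
      ∑ k ∈ S, b k * Complex.exp (Complex.I * (θ k : ℂ)) ≠
        ∑ k ∈ T, b k * Complex.exp (Complex.I * (θ k : ℂ)) := by
  classical
  simp only [ae_all_iff]
  intro S T hST
  obtain ⟨j, hj⟩ : ∃ j, ¬(j ∈ S ↔ j ∈ T) := by
    by_contra! h
    exact hST (Finset.ext h)
  have hne : (if j ∈ S then b j else 0) - (if j ∈ T then b j else 0) ≠ 0 := by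
    by_cases hS : j ∈ S <;> by_cases hT : j ∈ T <;> simp_all
  filter_upwards [ae_sum_mul_exp_I_mul_ne_zero
    (fun k => (if k ∈ S then b k else 0) - (if k ∈ T then b k else 0)) hne] with θ hθ h
  apply hθ
  simp [sub_mul, ite_mul, sum_sub_distrib, h]

/-- (Genericity of the `2^K` modes) For strictly positive amplitudes `β_k`, the set of phase
vectors `θ ∈ ℝ^K` for which two distinct subset sums `∑_{k∈S} β_k e^{iθ_k}` coincide has
Lebesgue measure zero; consequently, for almost every `θ` the `2^K` subset sums are pairwise
distinct. -/
theorem stmt_12 (K : ℕ) (hK : 0 < K) (β : Fin K → ℝ) (hβ : ∀ k, 0 < β k) :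
    volume {θ : Fin K → ℝ | ∃ S T : Finset (Fin K), S ≠ T ∧
      ∑ k ∈ S, (β k : ℂ) * Complex.exp (Complex.I * (θ k : ℂ)) =
        ∑ k ∈ T, (β k : ℂ) * Complex.exp (Complex.I * (θ k : ℂ))} = 0 ∧
    ∀ᵐ θ : Fin K → ℝ, ∀ S T : Finset (Fin K), S ≠ T →
      ∑ k ∈ S, (β k : ℂ) * Complex.exp (Complex.I * (θ k : ℂ)) ≠
        ∑ k ∈ T, (β k : ℂ) * Complex.exp (Complex.I * (θ k : ℂ)) := by
  have h := ae_subset_sums_ne (fun k => (β k : ℂ)) fun k => by exact_mod_cast (hβ k).ne'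
  refine ⟨?_, h⟩
  rw [ae_iff] at h
  convert h using 3
  push Not
  rfl
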